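/- Let r > 0 and let x ∈ [0,1]^d satisfy ‖x‖₁ = Σ_{i=1}^d x_i < 1, and let η ∼ NegMultinomial(r, x). Then for all distinct j₁, j₂ ∈ {1,…,d}, E[η_{j₁}² η_{j₂}²] = y_{j₁} y_{j₂}[(r+1)^{(2)} + (r+2)^{(3)}(y_{j₁} + y_{j₂}) + (r+3)^{(4)} y_{j₁} y_{j₂}], where m^{(k)} denotes the k-th order falling factorial of m. -/

import Mathlib

open scoped BigOperators

/-- The `k`-th order falling factorial `m^{(k)} = m(m-1)⋯(m-k+1)` of a real number `m`. -/
noncomputable def fallingFactorial (m : ℝ) (k : ℕ) : ℝ :=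
  ∏ i ∈ Finset.range k, (m - (i : ℝ))

/-- The probability mass function of the negative multinomial distribution
`NegMultinomial(r, x)` on `ℕ₀^d`. -/
noncomputable def negMultinomialPMF (d : ℕ) (r : ℝ) (x : Fin d → ℝ) (k : Fin d → ℕ) : ℝ :=
  Real.Gamma (r + ∑ i, (k i : ℝ)) / (Real.Gamma r * ∏ i, Real.Gamma ((k i : ℝ) + 1)) *
    (1 - ∑ i, x i) ^ r * ∏ i, (x i) ^ (k i)

theorem Real.Gamma_add_natCast_eq_multichoose (r : ℝ) (hr : 0 < r) (n : ℕ) :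
    Real.Gamma (r + n) = Real.Gamma r * (n.factorial * Ring.multichoose r n) := by
  have h := Ring.factorial_nsmul_multichoose_eq_ascPochhammer r n
  rw [nsmul_eq_mul, Polynomial.ascPochhammer_smeval_eq_eval] at h
  rw [h]
  clear h
  induction n with
  | zero => simp
  | succ n ih =>
    rw [ascPochhammer_succ_eval, ← mul_assoc, ← ih, Nat.cast_succ, ← add_assoc,
      Real.Gamma_add_one (by positivity), mul_comm]

theorem Real.hasSum_multichoose_mul_pow (r s : ℝ) (hs0 : 0 ≤ s) (hs1 : s < 1) :
    HasSum (fun n : ℕ => Ring.multichoose r n * s ^ n) ((1 - s) ^ (-r)) := by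
  have h := (Real.one_div_one_sub_rpow_hasFPowerSeriesOnBall_zero r).hasSum (y := s) (by
    simpa [Real.enorm_eq_ofReal hs0] using hs1)
  rw [zero_add, one_div, ← Real.rpow_neg (by linarith)] at h
  refine h.congr_fun fun n => ?_
  have e : r + (n : ℝ) - 1 - n + 1 = r := by ring
  simp [Ring.choose.eq_1, e, mul_comm]

theorem negMultinomialPMF_nonneg {d : ℕ} {r : ℝ} (hr : 0 < r) {x : Fin d → ℝ}
    (hx : ∀ i, 0 ≤ x i) (hx1 : ∑ i, x i < 1) (k : Fin d → ℕ) :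
    0 ≤ negMultinomialPMF d r x k := by
  have h1 : 0 < Real.Gamma (r + ∑ i, (k i : ℝ)) := Real.Gamma_pos_of_pos (by positivity)
  have h2 : 0 < Real.Gamma r := Real.Gamma_pos_of_pos hr
  have h3 : 0 < ∏ i, Real.Gamma ((k i : ℝ) + 1) :=
    Finset.prod_pos fun i _ => Real.Gamma_pos_of_pos (by positivity)
  have h4 : 0 ≤ ∏ i, (x i) ^ (k i) := Finset.prod_nonneg fun i _ => pow_nonneg (hx i) _
  have h5 : 0 ≤ (1 - ∑ i, x i) ^ r := Real.rpow_nonneg (by linarith) _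
  unfold negMultinomialPMF
  positivity

theorem negMultinomialPMF_eq {d : ℕ} {r : ℝ} (hr : 0 < r) (x : Fin d → ℝ) (k : Fin d → ℕ) :
    negMultinomialPMF d r x k = (1 - ∑ i, x i) ^ r * Ring.multichoose r (∑ i, k i) *
      (Nat.multinomial Finset.univ k * ∏ i, x i ^ k i) := by
  have hm : ((∏ i, (k i).factorial : ℕ) : ℝ) * Nat.multinomial Finset.univ k =
      ((∑ i, k i).factorial : ℝ) := by
    exact_mod_cast Nat.multinomial_spec Finset.univ k
  have hG : Real.Gamma r ≠ 0 := (Real.Gamma_pos_of_pos hr).ne'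
  have hP : ((∏ i, (k i).factorial : ℕ) : ℝ) ≠ 0 := by
    exact_mod_cast Finset.prod_ne_zero_iff.mpr fun i _ => (k i).factorial_ne_zero
  have hprod : ∏ i, Real.Gamma ((k i : ℝ) + 1) = ((∏ i, (k i).factorial : ℕ) : ℝ) := by
    push_cast
    exact Finset.prod_congr rfl fun i _ => Real.Gamma_nat_eq_factorial _
  rw [negMultinomialPMF, hprod, ← Nat.cast_sum, Real.Gamma_add_natCast_eq_multichoose r hr, ← hm]
  field_simp

theorem hasSum_negMultinomialPMF {d : ℕ} {r : ℝ} (hr : 0 < r) {x : Fin d → ℝ}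
    (hx : ∀ i, 0 ≤ x i) (hx1 : ∑ i, x i < 1) : HasSum (negMultinomialPMF d r x) 1 := by
  have hpos : 0 < 1 - ∑ i, x i := by linarith
  have hfib (n : ℕ) : HasSum (fun k : {k : Fin d → ℕ // ∑ i, k i = n} => negMultinomialPMF d r x k)
      ((1 - ∑ i, x i) ^ r * (Ring.multichoose r n * (∑ i, x i) ^ n)) := by
    have hval : (1 - ∑ i, x i) ^ r * (Ring.multichoose r n * (∑ i, x i) ^ n) =
        ∑ k ∈ Finset.piAntidiag Finset.univ n, negMultinomialPMF d r x k := by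
      rw [Finset.sum_pow_eq_sum_piAntidiag, Finset.mul_sum, Finset.mul_sum]
      refine Finset.sum_congr rfl fun k hk => ?_
      rw [negMultinomialPMF_eq hr, (Finset.mem_piAntidiag.1 hk).1, mul_assoc]
    rw [hval]
    have hset : {k : Fin d → ℕ | ∑ i, k i = n} = ((Finset.piAntidiag Finset.univ n : Finset (Fin d → ℕ)) : Set (Fin d → ℕ)) := by
      ext k
      simp
    change HasSum (fun k : {k : Fin d → ℕ | ∑ i, k i = n} => negMultinomialPMF d r x k) _
    rw [hset]
    exact (Finset.piAntidiag Finset.univ n).hasSum (negMultinomialPMF d r x)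
  have htot := (Real.hasSum_multichoose_mul_pow r (∑ i, x i)
    (Finset.sum_nonneg fun i _ => hx i) hx1).mul_left ((1 - ∑ i, x i) ^ r)
  rw [← Real.rpow_add hpos, add_neg_cancel, Real.rpow_zero] at htot
  rw [← (Equiv.sigmaFiberEquiv fun k : Fin d → ℕ => ∑ i, k i).hasSum_iff]
  have hs : Summable (negMultinomialPMF d r x ∘
      Equiv.sigmaFiberEquiv fun k : Fin d → ℕ => ∑ i, k i) := by
    refine (summable_sigma_of_nonneg fun k => negMultinomialPMF_nonneg hr hx hx1 _).2
      ⟨fun n => (hfib n).summable, ?_⟩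
    exact htot.summable.congr fun n => (hfib n).tsum_eq.symm
  exact ((hs.hasSum.sigma hfib).unique htot) ▸ hs.hasSum

theorem negMultinomialPMF_add_single_mul {d : ℕ} {r : ℝ} (hr : 0 < r) {x : Fin d → ℝ}
    (hx1 : ∑ i, x i < 1) (j : Fin d) (k : Fin d → ℕ) :
    negMultinomialPMF d r x (k + Pi.single j 1) * ((k j : ℝ) + 1) =
      r * (x j / (1 - ∑ i, x i)) * negMultinomialPMF d (r + 1) x k := by
  have hpos : 0 < 1 - ∑ i, x i := by linarith
  have hsum : ∑ i, (((k + Pi.single j 1 : Fin d → ℕ) i : ℕ) : ℝ) = 1 + ∑ i, (k i : ℝ) := by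
    simp [Finset.sum_add_distrib, Pi.single_apply, add_comm]
  have hpow : ∏ i, x i ^ (k + Pi.single j 1 : Fin d → ℕ) i = (∏ i, x i ^ k i) * x j := by
    simp [pow_add, Finset.prod_mul_distrib, Pi.single_apply, pow_ite, -mul_ite]
  have hgam : ∏ i, Real.Gamma (((k + Pi.single j 1 : Fin d → ℕ) i : ℝ) + 1) =
      (∏ i, Real.Gamma ((k i : ℝ) + 1)) * (k j + 1) := by
    have h (i) : Real.Gamma (((k + Pi.single j 1 : Fin d → ℕ) i : ℝ) + 1) =
        Real.Gamma ((k i : ℝ) + 1) * if i = j then (k j : ℝ) + 1 else 1 := by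
      rcases eq_or_ne i j with rfl | hij
      · simp [Real.Gamma_add_one (by positivity : (k i : ℝ) + 1 ≠ 0), mul_comm]
      · simp [hij]
    simp_rw [h, Finset.prod_mul_distrib]
    simp
  have hG : Real.Gamma r ≠ 0 := (Real.Gamma_pos_of_pos hr).ne'
  have hP : ∏ i, Real.Gamma ((k i : ℝ) + 1) ≠ 0 :=
    (Finset.prod_pos fun i _ => Real.Gamma_pos_of_pos (by positivity)).ne'
  have hk : (k j : ℝ) + 1 ≠ 0 := by positivity
  simp only [negMultinomialPMF]
  rw [hsum, hpow, hgam, Real.Gamma_add_one hr.ne', Real.rpow_add_one hpos.ne', ← add_assoc]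
  field_simp

/-- Size-biasing: weighting by one coordinate turns parameter `r` into `r + 1`. -/
theorem HasSum.negMultinomialPMF_coord_mul {d : ℕ} {r : ℝ} (hr : 0 < r) {x : Fin d → ℝ}
    (hx1 : ∑ i, x i < 1) (j : Fin d) {f : (Fin d → ℕ) → ℝ} {S : ℝ}
    (h : HasSum (fun k => negMultinomialPMF d (r + 1) x k * f (k + Pi.single j 1)) S) :
    HasSum (fun k => negMultinomialPMF d r x k * ((k j : ℝ) * f k))
      (r * (x j / (1 - ∑ i, x i)) * S) := by
  have hinj : Function.Injective fun k : Fin d → ℕ => k + Pi.single j 1 := add_left_injective _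
  rw [← hinj.hasSum_iff]
  · refine (h.mul_left (r * (x j / (1 - ∑ i, x i)))).congr_fun fun k => ?_
    rw [← mul_assoc, ← negMultinomialPMF_add_single_mul hr hx1]
    simp [mul_assoc]
  · intro k hk
    have : k j = 0 := by
      by_contra h0
      refine hk ⟨k - Pi.single j 1, ?_⟩
      ext i
      rcases eq_or_ne i j with rfl | hij
      · simp; omega
      · simp [hij]
    simp [this]

theorem negMultinomial_moment22 (d : ℕ) (r : ℝ) (hr : 0 < r) (x : Fin d → ℝ)
    (hx : ∀ i, x i ∈ Set.Icc (0 : ℝ) 1) (hx1 : ∑ i, x i < 1)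
    (y : Fin d → ℝ) (hy : ∀ i, y i = x i / (1 - ∑ j, x j))
    (j₁ j₂ : Fin d) (h12 : j₁ ≠ j₂) :
    (∑' η : Fin d → ℕ, negMultinomialPMF d r x η * ((η j₁ : ℝ) ^ 2 * (η j₂ : ℝ) ^ 2))
      = y j₁ * y j₂ * (fallingFactorial (r + 1) 2 + fallingFactorial (r + 2) 3 * (y j₁ + y j₂) +
          fallingFactorial (r + 3) 4 * (y j₁ * y j₂)) := by
  have h0 {s : ℝ} (hs : 0 < s) : HasSum (fun k => negMultinomialPMF d s x k * 1) 1 := by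
    simpa using hasSum_negMultinomialPMF hs (fun i => (hx i).1) hx1
  have mean {s : ℝ} (hs : 0 < s) (j : Fin d) :
      HasSum (fun k => negMultinomialPMF d s x k * ((k j : ℝ) * 1)) (s * y j * 1) := by
    rw [hy]
    exact (h0 (by positivity)).negMultinomialPMF_coord_mul hs hx1 j (f := fun _ => 1)
  have mixed {s : ℝ} (hs : 0 < s) :
      HasSum (fun k => negMultinomialPMF d s x k * ((k j₁ : ℝ) * (k j₂ : ℝ)))
        (s * y j₁ * ((s + 1) * y j₂)) := by
    rw [hy j₁]
    refine HasSum.negMultinomialPMF_coord_mul hs hx1 j₁ (f := fun k => (k j₂ : ℝ)) ?_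
    simpa [h12.symm] using mean (s := s + 1) (by positivity) j₂
  have hr2 : 0 < r + 1 + 1 := by positivity
  have key := (((mixed hr2).add (mean hr2 j₁)).add (mean hr2 j₂)).add (h0 hr2)
  have h1 := HasSum.negMultinomialPMF_coord_mul (r := r + 1) (by positivity) hx1 j₂
    (f := fun k => ((k j₁ : ℝ) + 1) * k j₂)
    (key.congr_fun fun k => by simp [h12]; ring)
  have h2 := HasSum.negMultinomialPMF_coord_mul hr hx1 j₁
    (f := fun k => (k j₁ : ℝ) * (k j₂ : ℝ) ^ 2)
    (h1.congr_fun fun k => by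
      simp only [Pi.add_apply, Pi.single_eq_same, Pi.single_eq_of_ne h12.symm]
      push_cast
      ring)
  rw [← hy, ← hy] at h2
  refine Eq.trans (tsum_congr fun k => ?_) (h2.tsum_eq.trans ?_)
  · ring
  · simp only [fallingFactorial, Finset.prod_range_succ, Finset.prod_range_zero]
    push_cast
    ring
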